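/- arXiv:1807.03563 — 7 statements merged into one kernel-verified Lean document; each statement's English description precedes it below -/
import Mathlib

section
/- Let k be a natural number, let c1 < c2 be real numbers and let s be any real number. For each natural number j define Φ_j : ℝ → ℝ by Φ_j(z) = z^{j+1}/(j+1) · (log|z| − 1/(j+1)) for z ≠ 0 and Φ_j(0) = 0. Then the function t ↦ t^k · log|s − t| is integrable on the interval (c1, c2), and its integral satisfies ∫_{c1}^{c2} t^k log|s − t| dt = Σ_{j=0}^{k} C(k,j) · s^{k−j} · (Φ_j(c2 − s) − Φ_j(c1 − s)), where C(k,j) denotes the binomial coefficient. -/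
open MeasureTheory intervalIntegral

/-- `Φ_j(z) = z^{j+1}/(j+1) · (log|z| − 1/(j+1))` for `z ≠ 0`, and `Φ_j(0) = 0`. -/
noncomputable def Phi (j : ℕ) (z : ℝ) : ℝ :=
  if z = 0 then 0 else z ^ (j + 1) / (j + 1) * (Real.log |z| - 1 / (j + 1))

lemma Phi_eq (j : ℕ) : Phi j = fun z : ℝ =>
    z ^ j / (j + 1) * (z * Real.log z - z * (1 / (j + 1))) := by
  funext z
  unfold Phi
  split_ifs with hz
  · simp [hz]
  · rw [Real.log_abs]; ring

lemma Phi_continuous (j : ℕ) : Continuous (Phi j) := by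
  rw [Phi_eq]
  have := Real.continuous_mul_log
  fun_prop

lemma Phi_hasDerivAt (j : ℕ) (z : ℝ) (hz : z ≠ 0) :
    HasDerivAt (Phi j) (z ^ j * Real.log z) z := by
  have h1 : Phi j = fun z : ℝ => z ^ (j + 1) / (j + 1) * (Real.log z - 1 / (j + 1)) := by
    rw [Phi_eq]; funext z; ring
  rw [h1]
  have h2 := ((hasDerivAt_pow (j + 1) z).div_const ((j : ℝ) + 1)).mul
    ((Real.hasDerivAt_log hz).sub_const (1 / ((j : ℝ) + 1)))
  refine h2.congr_deriv ?_
  have : (j : ℝ) + 1 ≠ 0 := by positivity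
  push_cast
  field_simp
  ring

/-- Closed form for `∫_{c1}^{c2} t^k log|s − t| dt` (open-curve modified moments). -/
theorem stmt0 (k : ℕ) (c1 c2 s : ℝ) (h : c1 < c2) :
    IntervalIntegrable (fun t => t ^ k * Real.log |s - t|) volume c1 c2 ∧
    ∫ t in c1..c2, t ^ k * Real.log |s - t| =
      ∑ j ∈ Finset.range (k + 1),
        (k.choose j : ℝ) * s ^ (k - j) * (Phi j (c2 - s) - Phi j (c1 - s)) := by
  have hint : IntervalIntegrable (fun t => t ^ k * Real.log |s - t|) volume c1 c2 := by
    have h0 : IntervalIntegrable (fun t => Real.log |s - t|) volume c1 c2 := by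
      have h1 := (intervalIntegrable_log' (a := c1 - s) (b := c2 - s)).comp_sub_right s
      simp only [sub_add_cancel] at h1
      have h2 : (fun t => Real.log |s - t|) = fun t => Real.log (t - s) := by
        funext t; rw [abs_sub_comm, Real.log_abs]
      rw [h2]; exact h1
    exact h0.continuousOn_mul (continuous_pow k).continuousOn
  refine ⟨hint, ?_⟩
  rw [MeasureTheory.integral_eq_of_hasDerivAt_off_countable
    (fun t => ∑ j ∈ Finset.range (k + 1), (k.choose j : ℝ) * s ^ (k - j) * Phi j (t - s))
    _ (Set.countable_singleton s) ?_ ?_ hint]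
  · rw [← Finset.sum_sub_distrib]
    exact Finset.sum_congr rfl fun j _ => by ring
  · apply Continuous.continuousOn
    refine continuous_finsetSum _ fun j _ => ?_
    exact continuous_const.mul ((Phi_continuous j).comp (continuous_id.sub continuous_const))
  · intro x hx
    have hxs : x - s ≠ 0 := sub_ne_zero.mpr hx.2
    have hd := HasDerivAt.fun_sum (u := Finset.range (k + 1)) fun j _ =>
      ((Phi_hasDerivAt j (x - s) hxs).comp_sub_const x s).const_mul
        ((k.choose j : ℝ) * s ^ (k - j))
    refine hd.congr_deriv ?_
    have hb := add_pow (x - s) s k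
    rw [sub_add_cancel] at hb
    rw [abs_sub_comm, Real.log_abs, hb, Finset.sum_mul]
    exact Finset.sum_congr rfl fun j _ => by ring
end

section
/- Let a < b be real numbers and set γ = b − a. Let F : [a,b] → ℝ² be a closed curve parametrization, i.e. F(a) = F(b), which is left-differentiable at b with one-sided derivative F′(b) ≠ 0, and suppose F(t) ≠ F(a) for all t in some left punctured neighbourhood of b. Define δ(a,t) = |a − t| · |(a−t)² − γ²| / γ². Then lim_{t → b⁻} ‖F(a) − F(t)‖ / δ(a,t) = ‖F′(b)‖ / 2, where ‖·‖ is the Euclidean norm on ℝ². -/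
open Filter

/-- For a closed curve `F` with `F(a) = F(b)`, left-differentiable at `b`, the ratio
`‖F(a) − F(t)‖/δ(a,t)`, with `δ(a,t) = |a − t|·|(a − t)² − γ²|/γ²` and `γ = b − a`,
tends to `‖F′(b)‖/2` as `t → b⁻`. -/
theorem stmt3 (a b : ℝ) (hab : a < b) (F : ℝ → EuclideanSpace ℝ (Fin 2))
    (F' : EuclideanSpace ℝ (Fin 2)) (hclosed : F a = F b)
    (hF : HasDerivWithinAt F F' (Set.Iic b) b) (hF' : F' ≠ 0)
    (hne : ∀ᶠ t in nhdsWithin b (Set.Iio b), F t ≠ F a) :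
    Tendsto (fun t => ‖F a - F t‖ / (|a - t| * |(a - t) ^ 2 - (b - a) ^ 2| / (b - a) ^ 2))
      (nhdsWithin b (Set.Iio b)) (nhds (‖F'‖ / 2)) := by
  have hs : Tendsto (slope F b) (nhdsWithin b (Set.Iio b)) (nhds F') := by
    have h := hasDerivWithinAt_iff_tendsto_slope.mp hF
    have hset : Set.Iic b \ {b} = Set.Iio b := Set.Iic_sdiff_right
    rwa [hset] at h
  have hg : Tendsto (fun t : ℝ => (b - a) ^ 2 / ((t - a) * (t + b - 2 * a)))
      (nhdsWithin b (Set.Iio b)) (nhds (1 / 2)) := by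
    have hpos : 0 < b - a := sub_pos.mpr hab
    have hval : (b - a) ^ 2 / ((b - a) * (b + b - 2 * a)) = 1 / 2 := by
      have h2 : b + b - 2 * a = 2 * (b - a) := by ring
      rw [h2]
      field_simp
    have hc : ContinuousAt (fun t : ℝ => (b - a) ^ 2 / ((t - a) * (t + b - 2 * a))) b := by
      apply ContinuousAt.div
      · fun_prop
      · fun_prop
      · have h2 : 0 < b + b - 2 * a := by linarith
        positivity
    have h := hc.tendsto
    rw [hval] at h
    exact h.mono_left nhdsWithin_le_nhds
  have hm := hs.norm.mul hg
  rw [mul_one_div] at hm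
  refine hm.congr' ?_
  have hlt : ∀ᶠ t in nhdsWithin b (Set.Iio b), a < t :=
    nhdsWithin_le_nhds (lt_mem_nhds hab)
  filter_upwards [hlt, self_mem_nhdsWithin] with t hat htb
  have htb' : t < b := htb
  have h1 : 0 < t - a := by linarith
  have h2 : 0 < b - t := by linarith
  have h3 : 0 < t + b - 2 * a := by linarith
  have h4 : 0 < b - a := by linarith
  have e1 : |a - t| = t - a := by rw [abs_sub_comm, abs_of_pos h1]
  have e2 : |(a - t) ^ 2 - (b - a) ^ 2| = (b - t) * (t + b - 2 * a) := by
    have h : (a - t) ^ 2 - (b - a) ^ 2 = -((b - t) * (t + b - 2 * a)) := by ring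
    rw [h, abs_neg, abs_of_pos (mul_pos h2 h3)]
  have e3 : ‖slope F b t‖ = (b - t)⁻¹ * ‖F a - F t‖ := by
    rw [slope_def_module, norm_smul, norm_inv, Real.norm_eq_abs, abs_sub_comm, abs_of_pos h2,
      hclosed, norm_sub_rev]
  rw [e1, e2, e3]
  field_simp
end

section
/- Let d be a natural number and let t_i ≤ t_{i+1} ≤ … ≤ t_{i+d+1} be real knots with t_i < t_{i+d+1}. Define the B-spline B_{i,d} by the Cox–de Boor recurrence: B_{j,0}(t) = 1 if t_j ≤ t < t_{j+1} and 0 otherwise; B_{j,r}(t) = ω_{j,r}(t) B_{j,r−1}(t) + (1 − ω_{j+1,r}(t)) B_{j+1,r−1}(t) for r = 1,…,d, where ω_{j,r}(t) = (t − t_j)/(t_{j+r} − t_j) if t_j < t_{j+r} and ω_{j,r}(t) = 0 otherwise. Then ∫_ℝ B_{i,d}(t) dt = (t_{i+d+1} − t_i) / (d + 1). -/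
open MeasureTheory

/-- The weight function of the Cox–de Boor recurrence. -/
noncomputable def omegaW (T : ℕ → ℝ) (j r : ℕ) (x : ℝ) : ℝ :=
  if T j < T (j + r) then (x - T j) / (T (j + r) - T j) else 0

/-- B-splines defined by the Cox–de Boor recurrence. -/
noncomputable def Bspline (T : ℕ → ℝ) : ℕ → ℕ → ℝ → ℝ
  | j, 0 => fun x => if T j ≤ x ∧ x < T (j + 1) then 1 else 0
  | j, r + 1 => fun x =>
      omegaW T j (r + 1) x * Bspline T j r x +
        (1 - omegaW T (j + 1) (r + 1) x) * Bspline T (j + 1) r x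

/-- Complete homogeneous symmetric polynomial of degree `k` in `T j, …, T (j+n)`. -/
noncomputable def hsym (T : ℕ → ℝ) (j : ℕ) : ℕ → ℕ → ℝ
  | 0, k => T j ^ k
  | _ + 1, 0 => 1
  | n + 1, k + 1 => hsym T j n (k + 1) + T (j + n + 1) * hsym T j (n + 1) k

theorem hsym_zero (T : ℕ → ℝ) (j n : ℕ) : hsym T j n 0 = 1 := by
  cases n <;> simp [hsym]

theorem hsym_succ (T : ℕ → ℝ) (j n k : ℕ) : hsym T j (n + 1) (k + 1)
    = hsym T j n (k + 1) + T (j + n + 1) * hsym T j (n + 1) k := by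
  rw [hsym]

theorem hsym_left (T : ℕ → ℝ) (j n k : ℕ) : hsym T j (n + 1) (k + 1)
    = hsym T (j + 1) n (k + 1) + T j * hsym T j (n + 1) k := by
  induction n generalizing k with
  | zero =>
    induction k with
    | zero => simp [hsym]; ring
    | succ k ih =>
      have h1 := hsym_succ T j 0 (k + 1)
      have h2 := hsym_succ T j 0 k
      have h0 : ∀ l i, hsym T i 0 l = T i ^ l := fun l i => by rw [hsym]
      simp only [h0, zero_add, add_zero] at *
      linear_combination h1 + T (j + 1) * ih - T j * h2
  | succ n ihn =>
    induction k with
    | zero =>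
      rw [hsym_succ T j (n + 1), ihn, hsym_succ T (j + 1) n]
      simp only [hsym_zero]
      rw [show j + 1 + n + 1 = j + (n + 1) + 1 by ring]; ring
    | succ k ih =>
      have h1 := hsym_succ T j (n + 1) (k + 1)
      have h2 := hsym_succ T j (n + 1) k
      have h3 := hsym_succ T (j + 1) n (k + 1)
      have h4 := ihn (k + 1)
      rw [show j + 1 + n + 1 = j + (n + 1) + 1 by ring] at h3
      linear_combination h1 + h4 + T (j + (n + 1) + 1) * ih - T j * h2 - h3

theorem hsym_const (T : ℕ → ℝ) (j : ℕ) (t : ℝ) (n k : ℕ) (h : ∀ m ≤ n, T (j + m) = t) :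
    hsym T j n k = ((n + k).choose k : ℝ) * t ^ k := by
  induction n generalizing k with
  | zero => simp [hsym]; rw [← h 0 le_rfl]; simp
  | succ n ihn =>
    induction k with
    | zero => simp [hsym]
    | succ k ih =>
      have hc : (n + 1 + (k + 1)).choose (k + 1)
          = (n + 1 + k).choose k + (n + (k + 1)).choose (k + 1) := by
        rw [show n + 1 + (k + 1) = (n + 1 + k) + 1 by ring, Nat.choose_succ_succ,
          show n + (k + 1) = n + 1 + k by ring]
      rw [hsym_succ, ihn _ (fun m hm => h m (by omega)), ih, hc, add_assoc, h (n + 1) le_rfl]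
      push_cast; ring

theorem knots_mono (T : ℕ → ℝ) (j r : ℕ) (hm : ∀ l, j ≤ l → l ≤ j + r → T l ≤ T (l + 1))
    (a b : ℕ) (hab : a ≤ b) (hb : b ≤ r + 1) : T (j + a) ≤ T (j + b) := by
  induction b, hab using Nat.le_induction with
  | base => exact le_rfl
  | succ b hab ih =>
    exact (ih (by omega)).trans (hm (j + b) (by omega) (by omega))

theorem Bspline_degenerate (T : ℕ → ℝ) (r j : ℕ)
    (h : ∀ m ≤ r + 1, T (j + m) = T j) (x : ℝ) : Bspline T j r x = 0 := by
  induction r generalizing j with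
  | zero =>
    have := h 1 le_rfl
    simp only [Bspline, this, ite_eq_right_iff]
    rintro ⟨h1, h2⟩; linarith
  | succ r ih =>
    have h1 := h 1 (by omega)
    simp only [Bspline]
    rw [ih j (fun m hm => h m (by omega)), ih (j + 1) (fun m hm => by
      rw [h1, add_assoc, h (1 + m) (by omega)])]
    simp

theorem knots_const (T : ℕ → ℝ) (j r : ℕ) (hm : ∀ l, j ≤ l → l ≤ j + r → T l ≤ T (l + 1))
    (hn : ¬ T j < T (j + (r + 1))) (m : ℕ) (h : m ≤ r + 1) : T (j + m) = T j := by
  have h1 := knots_mono T j r hm 0 m (by omega) h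
  have h2 := knots_mono T j r hm m (r + 1) h le_rfl
  simp only [add_zero] at h1
  linarith

/-- normalized moment -/
noncomputable def mom (T : ℕ → ℝ) (j n k : ℕ) : ℝ :=
  hsym T j n k / ((n + k).choose k : ℝ)

theorem choose_pos_real (n k : ℕ) : (0 : ℝ) < ((n + k).choose k : ℝ) := by
  exact_mod_cast Nat.choose_pos (by omega)

theorem mom_const (T : ℕ → ℝ) (j : ℕ) (t : ℝ) (n k : ℕ) (h : ∀ m ≤ n, T (j + m) = t) :
    mom T j n k = t ^ k := by
  have := choose_pos_real n k
  rw [mom, hsym_const T j t n k h]; field_simp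

theorem mom_step (T : ℕ → ℝ) (j r k : ℕ) :
    (mom T j (r + 1) (k + 1) - T j * mom T j (r + 1) k) / (r + 1)
     + (T (j + r + 2) * mom T (j + 1) (r + 1) k - mom T (j + 1) (r + 1) (k + 1)) / (r + 1)
    = (T (j + r + 2) - T j) * mom T j (r + 2) k / (r + 2) := by
  have e1 := hsym_succ T j (r + 1) k
  have e2 := hsym_left T j (r + 1) k
  have e3 : T (j + r + 2) * hsym T (j + 1) (r + 1) k - T j * hsym T j (r + 1) k
      = (T (j + r + 2) - T j) * hsym T j (r + 2) k := by
    cases k with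
    | zero => simp [hsym_zero]
    | succ k =>
      have e1 := hsym_succ T j (r + 1) k
      have e2 := hsym_left T j (r + 1) k
      rw [show j + (r + 1) + 1 = j + r + 2 by ring, show r + 1 + 1 = r + 2 by ring] at *
      linear_combination (T j) * e1 - (T (j + r + 2)) * e2
  rw [show j + (r + 1) + 1 = j + r + 2 by ring, show r + 1 + 1 = r + 2 by ring] at *
  have c0 := choose_pos_real (r + 1) k
  have c1 : (((r + 1 + (k + 1)).choose (k + 1) : ℕ) : ℝ)
      = ((r + 1 + k).choose k : ℝ) * (r + k + 2) / (k + 1) := by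
    have := Nat.add_one_mul_choose_eq (r + 1 + k) k
    have h : ((r + 1 + k + 1 : ℕ) : ℝ) * ((r + 1 + k).choose k : ℝ)
      = (((r + 1 + k + 1).choose (k + 1) : ℕ) : ℝ) * ((k + 1 : ℕ) : ℝ) := by exact_mod_cast this
    rw [show r + 1 + (k + 1) = r + 1 + k + 1 by ring]
    push_cast at h
    field_simp
    linear_combination -h
  have c2 : (((r + 2 + k).choose k : ℕ) : ℝ)
      = ((r + 1 + k).choose k : ℝ) * (r + k + 2) / (r + 2) := by
    have := Nat.add_one_mul_choose_eq (r + 1 + k) (r + 1)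
    have h : ((r + 1 + k + 1 : ℕ) : ℝ) * ((r + 1 + k).choose (r + 1) : ℝ)
      = (((r + 1 + k + 1).choose (r + 1 + 1) : ℕ) : ℝ) * ((r + 1 + 1 : ℕ) : ℝ) := by
      exact_mod_cast this
    rw [show r + 1 + k + 1 = r + 2 + k by ring, show r + 1 + 1 = r + 2 by ring,
      Nat.choose_symm_add, Nat.choose_symm_add] at h
    push_cast at h
    field_simp
    linear_combination -h
  simp only [mom, c1, c2]
  have hr : (0 : ℝ) < (r : ℝ) + k + 2 := by positivity
  have e4 : hsym T j (r + 1) (k + 1) - hsym T (j + 1) (r + 1) (k + 1)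
      = - (T (j + r + 2) - T j) * hsym T j (r + 2) k := by linear_combination e2 - e1
  field_simp
  linear_combination (k + 1 : ℝ) * e4 + (r + k + 2 : ℝ) * e3

theorem moments (T : ℕ → ℝ) (r : ℕ) : ∀ j, (∀ l, j ≤ l → l ≤ j + r → T l ≤ T (l + 1)) →
    ∀ k, Integrable (fun x => x ^ k * Bspline T j r x) ∧
      ∫ x, x ^ k * Bspline T j r x
        = (T (j + (r + 1)) - T j) * mom T j (r + 1) k / (r + 1) := by
  induction r with
  | zero =>
    intro j hm k
    have hle : T j ≤ T (j + 1) := hm j le_rfl le_rfl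
    have hf : (fun x => x ^ k * Bspline T j 0 x)
        = (Set.Ico (T j) (T (j + 1))).indicator (fun x => x ^ k) := by
      ext x
      simp [Bspline, Set.indicator_apply]
    constructor
    · rw [hf, integrable_indicator_iff measurableSet_Ico]
      exact ((continuous_pow k).continuousOn.integrableOn_compact isCompact_Icc).mono_set
        Set.Ico_subset_Icc_self
    · rw [hf, integral_indicator measurableSet_Ico, integral_Ico_eq_integral_Ioc,
        ← intervalIntegral.integral_of_le hle, integral_pow]
      have hs : ∀ k, (T (j + 1) - T j) * hsym T j 1 k = T (j + 1) ^ (k + 1) - T j ^ (k + 1) := by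
        intro k
        have e1 := hsym_succ T j 0 k
        have e2 := hsym_left T j 0 k
        simp only [hsym, add_zero, zero_add] at *
        linear_combination e2 - e1
      have hc : (1 + k).choose k = k + 1 := by rw [add_comm, Nat.choose_succ_self_right]
      simp only [mom, zero_add, hc, ← hs]
      push_cast; ring
  | succ r ih =>
    intro j hm k
    have hm1 : ∀ l, j ≤ l → l ≤ j + r → T l ≤ T (l + 1) := fun l h1 h2 => hm l h1 (by omega)
    have hm2 : ∀ l, j + 1 ≤ l → l ≤ j + 1 + r → T l ≤ T (l + 1) :=
      fun l h1 h2 => hm l (by omega) (by omega)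
    have hA : Integrable (fun x => x ^ k * (omegaW T j (r + 1) x * Bspline T j r x)) ∧
        ∫ x, x ^ k * (omegaW T j (r + 1) x * Bspline T j r x)
          = (mom T j (r + 1) (k + 1) - T j * mom T j (r + 1) k) / (r + 1) := by
      by_cases h : T j < T (j + (r + 1))
      · obtain ⟨i0, v0⟩ := ih j hm1 k
        obtain ⟨i1, v1⟩ := ih j hm1 (k + 1)
        have hd : T (j + (r + 1)) - T j ≠ 0 := by linarith
        have hf : (fun x => x ^ k * (omegaW T j (r + 1) x * Bspline T j r x))
          = fun x => (T (j + (r + 1)) - T j)⁻¹ *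
            (x ^ (k + 1) * Bspline T j r x - T j * (x ^ k * Bspline T j r x)) := by
          ext x
          simp only [omegaW, if_pos h]; field_simp; ring
        rw [hf]
        refine ⟨(i1.sub (i0.const_mul _)).const_mul _, ?_⟩
        rw [integral_const_mul, integral_sub i1 (i0.const_mul _), integral_const_mul, v0, v1]
        field_simp
      · have hc := knots_const T j r hm1 h
        have hz := Bspline_degenerate T r j hc
        simp only [hz, mom_const T j (T j) (r + 1) _ hc]
        simp [pow_succ']
    have hB : Integrable (fun x => x ^ k *
          ((1 - omegaW T (j + 1) (r + 1) x) * Bspline T (j + 1) r x)) ∧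
        ∫ x, x ^ k * ((1 - omegaW T (j + 1) (r + 1) x) * Bspline T (j + 1) r x)
          = (T (j + r + 2) * mom T (j + 1) (r + 1) k - mom T (j + 1) (r + 1) (k + 1))
            / (r + 1) := by
      rw [show j + r + 2 = j + 1 + (r + 1) by ring]
      by_cases h : T (j + 1) < T (j + 1 + (r + 1))
      · obtain ⟨i0, v0⟩ := ih (j + 1) hm2 k
        obtain ⟨i1, v1⟩ := ih (j + 1) hm2 (k + 1)
        have hd : T (j + 1 + (r + 1)) - T (j + 1) ≠ 0 := by linarith
        have hf : (fun x => x ^ k * ((1 - omegaW T (j + 1) (r + 1) x) * Bspline T (j + 1) r x))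
          = fun x => (T (j + 1 + (r + 1)) - T (j + 1))⁻¹ *
            (T (j + 1 + (r + 1)) * (x ^ k * Bspline T (j + 1) r x)
              - x ^ (k + 1) * Bspline T (j + 1) r x) := by
          ext x
          simp only [omegaW, if_pos h]; field_simp; ring
        rw [hf]
        refine ⟨((i0.const_mul _).sub i1).const_mul _, ?_⟩
        rw [integral_const_mul, integral_sub (i0.const_mul _) i1, integral_const_mul, v0, v1]
        field_simp
      · have hc := knots_const T (j + 1) r hm2 h
        have hz := Bspline_degenerate T r (j + 1) hc
        simp only [hz, mom_const T (j + 1) (T (j + 1)) (r + 1) _ hc, hc (r + 1) le_rfl]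
        simp [pow_succ']
    have hf : (fun x => x ^ k * Bspline T j (r + 1) x)
        = fun x => x ^ k * (omegaW T j (r + 1) x * Bspline T j r x) +
          x ^ k * ((1 - omegaW T (j + 1) (r + 1) x) * Bspline T (j + 1) r x) := by
      ext x; simp only [Bspline]; ring
    rw [hf]
    refine ⟨hA.1.add hB.1, ?_⟩
    rw [integral_add hA.1 hB.1, hA.2, hB.2, mom_step]
    push_cast
    rw [show j + (r + 1 + 1) = j + r + 2 by ring, show (r : ℝ) + 1 + 1 = r + 2 by ring]

/-- The definite integral of a degree `d` B-spline equals the length of its support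
divided by `d + 1`. -/
theorem stmt4 (d i : ℕ) (T : ℕ → ℝ)
    (hmono : ∀ j, i ≤ j → j ≤ i + d → T j ≤ T (j + 1))
    (hsupp : T i < T (i + d + 1)) :
    ∫ x, Bspline T i d x = (T (i + d + 1) - T i) / (d + 1) := by
  have h := (moments T d i hmono 0).2
  simp only [pow_zero, one_mul] at h
  rw [h]
  simp [mom, hsym_zero, add_assoc]
end

section
/- For every natural number d and every γ > 0 there exists a constant C > 0, depending only on d and γ, such that for every h with 0 < h < e^{-1}, every s ∈ [0, γ], and every interval D ⊆ [0, γ] of length (d+1)h, one has ∫_D | log δ(s,t) | dt ≤ C · h · |log h|, where δ(s,t) = |s − t| · |(s−t)² − γ²| / γ². -/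
open MeasureTheory intervalIntegral

/-- truncated logarithm -/
noncomputable def gTrunc : ℝ → ℝ := Set.indicator (Set.Ioc (-1) 1) (fun u => -Real.log u)

lemma gTrunc_nonneg (u : ℝ) : 0 ≤ gTrunc u := by
  unfold gTrunc
  apply Set.indicator_nonneg
  intro x hx
  rw [← Real.log_abs]
  have h1 : |x| ≤ 1 := abs_le.2 ⟨hx.1.le, hx.2⟩
  have := Real.log_nonpos (abs_nonneg x) h1
  linarith

lemma gTrunc_integrable : Integrable gTrunc := by
  unfold gTrunc
  rw [integrable_indicator_iff measurableSet_Ioc]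
  have := (intervalIntegral.intervalIntegrable_log' (a := -1) (b := 1)).neg
  exact this.1

lemma gTrunc_integral : ∫ u, gTrunc u = 2 := by
  unfold gTrunc
  rw [MeasureTheory.integral_indicator measurableSet_Ioc,
    ← intervalIntegral.integral_of_le (by norm_num), intervalIntegral.integral_neg, integral_log]
  simp
  norm_num

lemma log_pt (x h M : ℝ) (hh : 0 < h) (hM : 1 ≤ M) (hx : |x| ≤ M) :
    |Real.log x| ≤ Real.log M + |Real.log h| + gTrunc (x / h) := by
  have hM0 := Real.log_nonneg hM
  have hg := gTrunc_nonneg (x / h)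
  have ha := abs_nonneg (Real.log h)
  rcases eq_or_ne x 0 with rfl | hx0
  · simp only [Real.log_zero, abs_zero]; linarith
  have h1 : Real.log x ≤ Real.log M := by
    rw [← Real.log_abs]; exact Real.log_le_log (abs_pos.2 hx0) hx
  rw [abs_le]
  refine ⟨?_, by linarith⟩
  have hd : Real.log (x / h) = Real.log x - Real.log h := Real.log_div hx0 hh.ne'
  have h2 : -gTrunc (x / h) ≤ Real.log (x / h) := by
    by_cases hm : x / h ∈ Set.Ioc (-1 : ℝ) 1
    · simp [gTrunc, Set.indicator_of_mem hm]
    · have : 1 ≤ |x / h| := by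
        by_contra hc
        have := abs_lt.1 (not_le.1 hc)
        exact hm ⟨this.1, this.2.le⟩
      have := Real.log_nonneg this
      rw [Real.log_abs] at this
      linarith
  have := neg_abs_le (Real.log h)
  linarith

lemma log_int (p c L h M : ℝ) (hL : 0 ≤ L) (hh : 0 < h) (hM : 1 ≤ M)
    (hx : ∀ t ∈ Set.Icc c (c + L), |t - p| ≤ M) :
    IntervalIntegrable (fun t => |Real.log (t - p)|) volume c (c + L) ∧
    ∫ t in c..(c + L), |Real.log (t - p)| ≤ L * (Real.log M + |Real.log h|) + 2 * h := by
  have hi : IntervalIntegrable (fun t => |Real.log (t - p)|) volume c (c + L) := by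
    have := (intervalIntegral.intervalIntegrable_log' (a := c - p) (b := c + L - p)).comp_sub_right p
    simpa using this.abs
  refine ⟨hi, ?_⟩
  have hgi : Integrable (fun t => gTrunc ((t - p) / h)) :=
    (gTrunc_integrable.comp_div hh.ne').comp_sub_right p
  have hgI : ∫ t, gTrunc ((t - p) / h) = 2 * h := by
    rw [MeasureTheory.integral_sub_right_eq_self (fun t => gTrunc (t / h)) p,
      MeasureTheory.Measure.integral_comp_div, gTrunc_integral, abs_of_pos hh, smul_eq_mul]
    ring
  have hci : IntervalIntegrable (fun _ : ℝ => Real.log M + |Real.log h|) volume c (c + L) :=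
    intervalIntegrable_const
  calc ∫ t in c..(c + L), |Real.log (t - p)|
      ≤ ∫ t in c..(c + L), ((Real.log M + |Real.log h|) + gTrunc ((t - p) / h)) := by
        apply intervalIntegral.integral_mono_on (by linarith) hi (hci.add hgi.intervalIntegrable)
        intro t ht
        exact log_pt _ _ _ hh hM (hx t ht)
    _ = L * (Real.log M + |Real.log h|) + ∫ t in c..(c + L), gTrunc ((t - p) / h) := by
        rw [intervalIntegral.integral_add hci hgi.intervalIntegrable,
          intervalIntegral.integral_const]
        simp
    _ ≤ _ := by
        rw [← hgI, intervalIntegral.integral_of_le (by linarith)]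
        have := setIntegral_le_integral (s := Set.Ioc c (c + L)) hgi (Filter.Eventually.of_forall fun t => gTrunc_nonneg _)
        linarith

lemma delta_pt (s t γ : ℝ) (hγ : 0 < γ) :
    |Real.log (|s - t| * |(s - t) ^ 2 - γ ^ 2| / γ ^ 2)| ≤
      |Real.log (t - s)| + |Real.log (t - (s + γ))| + |Real.log (t - (s - γ))|
        + 2 * |Real.log γ| := by
  have e : |s - t| * |(s - t) ^ 2 - γ ^ 2| = |(t - s) * (t - (s + γ)) * (t - (s - γ))| := by
    rw [← abs_mul, ← abs_neg]; congr 1; ring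
  rw [e]
  have n1 := abs_nonneg (Real.log (t - s))
  have n2 := abs_nonneg (Real.log (t - (s + γ)))
  have n3 := abs_nonneg (Real.log (t - (s - γ)))
  have n4 := abs_nonneg (Real.log γ)
  by_cases hz : (t - s) * (t - (s + γ)) * (t - (s - γ)) = 0
  · rw [hz]; simp only [abs_zero, zero_div, Real.log_zero]; linarith
  · have hz' := hz
    simp only [mul_eq_zero, not_or] at hz'
    obtain ⟨⟨a1, a2⟩, a3⟩ := hz'
    rw [Real.log_div (abs_ne_zero.2 hz) (by positivity), Real.log_abs,
      Real.log_mul (mul_ne_zero a1 a2) a3, Real.log_mul a1 a2, Real.log_pow]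
    push_cast
    rw [abs_le]
    have := neg_abs_le (Real.log (t - s))
    have := neg_abs_le (Real.log (t - (s + γ)))
    have := neg_abs_le (Real.log (t - (s - γ)))
    have := neg_abs_le (Real.log γ)
    have := le_abs_self (Real.log (t - s))
    have := le_abs_self (Real.log (t - (s + γ)))
    have := le_abs_self (Real.log (t - (s - γ)))
    have := le_abs_self (Real.log γ)
    constructor <;> linarith

/-- Closed-curve analogue of the logarithmic integral estimate: for
`δ(s,t) = |s−t|·|(s−t)²−γ²|/γ²` there is `C > 0` (depending only on `d` and `γ`) such that
for every `0 < h < e⁻¹`, every `s ∈ [0,γ]` and every interval `D ⊆ [0,γ]` of length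
`(d+1)h`, one has `∫_D |log δ(s,t)| dt ≤ C·h·|log h|`. -/
theorem stmt7 (d : ℕ) (γ : ℝ) (hγ : 0 < γ) :
    ∃ C > 0, ∀ h : ℝ, 0 < h → h < Real.exp (-1) →
      ∀ s ∈ Set.Icc (0 : ℝ) γ, ∀ c : ℝ,
        Set.Icc c (c + ((d : ℝ) + 1) * h) ⊆ Set.Icc (0 : ℝ) γ →
        ∫ t in c..(c + ((d : ℝ) + 1) * h),
            |Real.log (|s - t| * |(s - t) ^ 2 - γ ^ 2| / γ ^ 2)|
          ≤ C * h * |Real.log h| := by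
  have hM : (1 : ℝ) ≤ 1 + 2 * γ := by linarith
  set A := Real.log (1 + 2 * γ) with hA
  have hA0 : 0 ≤ A := Real.log_nonneg hM
  have hG0 := abs_nonneg (Real.log γ)
  refine ⟨3 * (((d : ℝ) + 1) * (A + 1) + 2) + ((d : ℝ) + 1) * (2 * |Real.log γ|), by positivity, ?_⟩
  intro h hh hhe s hs c hc
  set L := ((d : ℝ) + 1) * h with hL
  have hL0 : 0 ≤ L := by positivity
  have hl : 1 ≤ |Real.log h| := by
    have := Real.log_lt_log hh hhe
    rw [Real.log_exp] at this
    rw [abs_of_neg (by linarith)]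
    linarith
  have ht : ∀ t ∈ Set.Icc c (c + L), 0 ≤ t ∧ t ≤ γ := fun t ht => hc ht
  obtain ⟨hs0, hs1⟩ := hs
  obtain ⟨i1, b1⟩ := log_int s c L h _ hL0 hh hM (fun t h => by
    have := ht t h; rw [abs_le]; constructor <;> linarith)
  obtain ⟨i2, b2⟩ := log_int (s + γ) c L h _ hL0 hh hM (fun t h => by
    have := ht t h; rw [abs_le]; constructor <;> linarith)
  obtain ⟨i3, b3⟩ := log_int (s - γ) c L h _ hL0 hh hM (fun t h => by
    have := ht t h; rw [abs_le]; constructor <;> linarith)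
  have i4 : IntervalIntegrable (fun _ : ℝ => 2 * |Real.log γ|) volume c (c + L) :=
    intervalIntegrable_const
  have hiR := ((i1.add i2).add i3).add i4
  have key : ∫ t in c..(c + L), |Real.log (|s - t| * |(s - t) ^ 2 - γ ^ 2| / γ ^ 2)| ≤
      ∫ t in c..(c + L), (|Real.log (t - s)| + |Real.log (t - (s + γ))|
        + |Real.log (t - (s - γ))| + 2 * |Real.log γ|) := by
    rw [intervalIntegral.integral_of_le (by linarith), intervalIntegral.integral_of_le (by linarith)]
    exact integral_mono_of_nonneg (Filter.Eventually.of_forall fun t => abs_nonneg _) hiR.1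
      (Filter.Eventually.of_forall fun t => delta_pt s t γ hγ)
  rw [intervalIntegral.integral_add ((i1.add i2).add i3) i4,
    intervalIntegral.integral_add (i1.add i2) i3, intervalIntegral.integral_add i1 i2,
    intervalIntegral.integral_const] at key
  simp only [add_sub_cancel_left, smul_eq_mul] at key
  rw [← hA] at b1 b2 b3
  have q1 : L * A ≤ L * A * |Real.log h| := le_mul_of_one_le_right (by positivity) hl
  have q2 : 2 * h ≤ 2 * h * |Real.log h| := le_mul_of_one_le_right (by positivity) hl
  have q3 : L * (2 * |Real.log γ|) ≤ L * (2 * |Real.log γ|) * |Real.log h| :=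
    le_mul_of_one_le_right (by positivity) hl
  have e : (3 * (((d : ℝ) + 1) * (A + 1) + 2) + ((d : ℝ) + 1) * (2 * |Real.log γ|)) * h * |Real.log h|
      = 3 * (L * A * |Real.log h| + L * |Real.log h| + 2 * h * |Real.log h|)
        + L * (2 * |Real.log γ|) * |Real.log h| := by rw [hL]; ring
  rw [e]
  linarith
end

section
/- For every real x with −1 < x < 1, the function y ↦ (y / √(1 − y²)) · log|x − y| is integrable on (−1, 1) and ∫_{−1}^{1} (y / √(1 − y²)) · log|x − y| dy = −π x. -/
open MeasureTheory intervalIntegral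

lemma aux_integrable (a : ℝ) :
    IntervalIntegrable (fun t => Real.cos t * Real.log |Real.cos a - Real.cos t|)
      volume 0 Real.pi := by
  have h : IntervalIntegrable (fun t => Real.log ‖Real.cos a - Real.cos t‖) volume 0 Real.pi := by
    apply MeromorphicOn.intervalIntegrable_log_norm
    intro t _
    exact (analyticAt_const.sub Real.analyticAt_cos).meromorphicAt
  exact h.continuousOn_mul Real.continuous_cos.continuousOn

/-- An antiderivative, continuous across the singularity. -/
noncomputable def auxF (a t : ℝ) : ℝ :=
  2 * Real.cos ((t + a) / 2) * (Real.sin ((t - a) / 2) * Real.log (Real.sin ((t - a) / 2)))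
  + 2 * Real.cos ((t - a) / 2) * (Real.sin ((t + a) / 2) * Real.log (Real.sin ((t + a) / 2)))
  + Real.sin t * (Real.log 2 - 1) - Real.cos a * t

lemma auxF_continuous (a : ℝ) : Continuous (auxF a) := by
  have h1 : Continuous fun t : ℝ =>
      Real.sin ((t - a) / 2) * Real.log (Real.sin ((t - a) / 2)) :=
    Real.Continuous.mul_log (by fun_prop)
  have h2 : Continuous fun t : ℝ =>
      Real.sin ((t + a) / 2) * Real.log (Real.sin ((t + a) / 2)) :=
    Real.Continuous.mul_log (by fun_prop)
  unfold auxF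
  fun_prop

lemma auxF_deriv (a t : ℝ) (h : Real.cos a - Real.cos t ≠ 0) :
    HasDerivAt (auxF a) (Real.cos t * Real.log |Real.cos a - Real.cos t|) t := by
  have e : Real.cos a - Real.cos t = 2 * (Real.sin ((t - a) / 2) * Real.sin ((t + a) / 2)) := by
    have := Real.cos_sub_cos t a
    linarith
  have hu : Real.sin ((t - a) / 2) ≠ 0 := by
    intro h0; apply h; rw [e, h0]; ring
  have hv : Real.sin ((t + a) / 2) ≠ 0 := by
    intro h0; apply h; rw [e, h0]; ring
  have m : HasDerivAt (fun t : ℝ => (t - a) / 2) (1 / 2) t :=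
    ((hasDerivAt_id t).sub_const a).div_const 2
  have p : HasDerivAt (fun t : ℝ => (t + a) / 2) (1 / 2) t :=
    ((hasDerivAt_id t).add_const a).div_const 2
  have d1 := (p.cos.const_mul 2).mul ((Real.hasDerivAt_mul_log hu).comp t m.sin)
  have d2 := (m.cos.const_mul 2).mul ((Real.hasDerivAt_mul_log hv).comp t p.sin)
  have d := ((d1.add d2).add ((Real.hasDerivAt_sin t).mul_const (Real.log 2 - 1))).sub
    ((hasDerivAt_id t).const_mul (Real.cos a))
  refine HasDerivAt.congr_deriv (f := auxF a) d ?_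
  rw [Real.log_abs, e, Real.log_mul two_ne_zero (mul_ne_zero hu hv), Real.log_mul hu hv]
  have ct : Real.cos t = Real.cos ((t - a) / 2) * Real.cos ((t + a) / 2)
      - Real.sin ((t - a) / 2) * Real.sin ((t + a) / 2) := by
    rw [← Real.cos_add]; congr 1; ring
  have ca : Real.cos a = Real.cos ((t - a) / 2) * Real.cos ((t + a) / 2)
      + Real.sin ((t - a) / 2) * Real.sin ((t + a) / 2) := by
    rw [← Real.cos_sub, ← Real.cos_neg]; congr 1; ring
  simp only [Function.comp]
  rw [ct, ca]
  ring

lemma aux_integral (a : ℝ) (ha : a ∈ Set.Icc 0 Real.pi) :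
    ∫ t in (0 : ℝ)..Real.pi, Real.cos t * Real.log |Real.cos a - Real.cos t|
      = -(Real.pi * Real.cos a) := by
  rw [integral_eq_of_hasDerivAt_off_countable_of_le (auxF a) _ Real.pi_pos.le
    (Set.countable_singleton a) (auxF_continuous a).continuousOn ?_ (aux_integrable a)]
  · have e1 : (Real.pi + a) / 2 = a / 2 + Real.pi / 2 := by ring
    have e2 : (Real.pi - a) / 2 = Real.pi / 2 - a / 2 := by ring
    have e3 : (0 - a) / 2 = -(a / 2) := by ring
    simp only [auxF, e1, e2, e3, zero_add, Real.cos_add_pi_div_two, Real.sin_add_pi_div_two,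
      Real.cos_pi_div_two_sub, Real.sin_pi_div_two_sub, Real.sin_neg, Real.cos_neg,
      Real.log_neg_eq_log, Real.sin_pi, Real.sin_zero]
    ring
  · intro t ht
    apply auxF_deriv
    intro h
    exact ht.2 (Real.injOn_cos ⟨ht.1.1.le, ht.1.2.le⟩ ha (sub_eq_zero.mp h).symm)

/-- `φ(y) = −y/√(1−y²)` solves the Symm equation on the slit:
`∫_{−1}^{1} (y/√(1−y²)) log|x−y| dy = −π x` for every `x ∈ (−1,1)`. -/
theorem stmt11 (x : ℝ) (hx : x ∈ Set.Ioo (-1 : ℝ) 1) :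
    IntervalIntegrable (fun y => y / Real.sqrt (1 - y ^ 2) * Real.log |x - y|)
      volume (-1) 1 ∧
    ∫ y in (-1 : ℝ)..1, y / Real.sqrt (1 - y ^ 2) * Real.log |x - y| = -(Real.pi * x) := by
  obtain ⟨a, ha, rfl⟩ : ∃ a ∈ Set.Icc 0 Real.pi, Real.cos a = x :=
    ⟨Real.arccos x, ⟨Real.arccos_nonneg x, Real.arccos_le_pi x⟩,
      Real.cos_arccos hx.1.le hx.2.le⟩
  have him : Real.cos '' Set.Ioo 0 Real.pi = Set.Ioo (-1) 1 := by
    ext y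
    constructor
    · rintro ⟨t, ht, rfl⟩
      have hs := Real.sin_pos_of_pos_of_lt_pi ht.1 ht.2
      have := Real.sin_sq_add_cos_sq t
      constructor <;> nlinarith
    · intro hy
      refine ⟨Real.arccos y, ⟨Real.arccos_pos.2 hy.2, ?_⟩, Real.cos_arccos hy.1.le hy.2.le⟩
      refine lt_of_le_of_ne (Real.arccos_le_pi y) ?_
      intro h
      have := Real.arccos_eq_pi.1 h
      linarith [hy.1]
  have hd : ∀ t ∈ Set.Ioo 0 Real.pi,
      HasDerivWithinAt Real.cos (-Real.sin t) (Set.Ioo 0 Real.pi) t :=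
    fun t _ => (Real.hasDerivAt_cos t).hasDerivWithinAt
  have hinj : Set.InjOn Real.cos (Set.Ioo 0 Real.pi) :=
    Real.injOn_cos.mono Set.Ioo_subset_Icc_self
  have heq : Set.EqOn (fun t => |-Real.sin t| •
      (Real.cos t / Real.sqrt (1 - Real.cos t ^ 2) * Real.log |Real.cos a - Real.cos t|))
      (fun t => Real.cos t * Real.log |Real.cos a - Real.cos t|) (Set.Ioo 0 Real.pi) := by
    intro t ht
    have hs := Real.sin_pos_of_pos_of_lt_pi ht.1 ht.2
    have : Real.sqrt (1 - Real.cos t ^ 2) = Real.sin t := by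
      rw [← Real.sin_sq, Real.sqrt_sq hs.le]
    simp only [this, abs_neg, abs_of_pos hs, smul_eq_mul]
    field_simp
  have h1 : (-1 : ℝ) ≤ 1 := by norm_num
  constructor
  · rw [intervalIntegrable_iff_integrableOn_Ioo_of_le h1, ← him,
      integrableOn_image_iff_integrableOn_abs_deriv_smul measurableSet_Ioo hd hinj,
      integrableOn_congr_fun heq measurableSet_Ioo,
      ← intervalIntegrable_iff_integrableOn_Ioo_of_le Real.pi_pos.le]
    exact aux_integrable a
  · rw [integral_of_le h1, integral_Ioc_eq_integral_Ioo, ← him,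
      integral_image_eq_integral_abs_deriv_smul measurableSet_Ioo hd hinj,
      setIntegral_congr_fun measurableSet_Ioo heq, ← integral_Ioc_eq_integral_Ioo,
      ← integral_of_le Real.pi_pos.le]
    exact aux_integral a ha
end

section
/- With φ(x) = −x / √(1 − x²) on (−1, 1), the function (x, y) ↦ log|x − y| · φ(x) · φ(y) = (x y log|x − y|) / (√(1 − x²) √(1 − y²)) is integrable on (−1,1) × (−1,1), and −(1/(2π)) ∫_{−1}^{1} ∫_{−1}^{1} log|x − y| · φ(x) φ(y) dy dx = π/4. -/
open MeasureTheory

lemma img_cos : Set.image Real.cos (Set.Ioo 0 Real.pi) = Set.Ioo (-1:ℝ) 1 := by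
  ext x
  constructor
  · rintro ⟨t, ht, rfl⟩
    have h1 := Real.strictAntiOn_cos ⟨le_refl 0, Real.pi_pos.le⟩ ⟨ht.1.le, ht.2.le⟩ ht.1
    have h2 := Real.strictAntiOn_cos ⟨ht.1.le, ht.2.le⟩ ⟨Real.pi_pos.le, le_refl _⟩ ht.2
    simp at h1 h2
    exact ⟨h2, h1⟩
  · rintro ⟨h1, h2⟩
    exact ⟨Real.arccos x, ⟨Real.arccos_pos.2 h2, Real.arccos_lt_pi.2 h1⟩, Real.cos_arccos h1.le h2.le⟩

lemma cv_point (g : ℝ → ℝ) : ∀ t ∈ Set.Ioo 0 Real.pi,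
    |-Real.sin t| • (g (Real.cos t) / Real.sqrt (1 - Real.cos t ^ 2)) = g (Real.cos t) := by
  intro t ht
  have h := Real.sin_pos_of_pos_of_lt_pi ht.1 ht.2
  rw [← Real.sin_sq, Real.sqrt_sq h.le, abs_neg, abs_of_pos h, smul_eq_mul]
  field_simp

lemma cv_int (g : ℝ → ℝ) : ∫ x in Set.Ioo (-1:ℝ) 1, g x / Real.sqrt (1 - x ^ 2)
    = ∫ t in Set.Ioo 0 Real.pi, g (Real.cos t) := by
  rw [← img_cos, integral_image_eq_integral_abs_deriv_smul (f' := fun t => -Real.sin t)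
    measurableSet_Ioo (fun t _ => (Real.hasDerivAt_cos t).hasDerivWithinAt)
    (Real.injOn_cos.mono Set.Ioo_subset_Icc_self)]
  exact setIntegral_congr_fun measurableSet_Ioo (cv_point g)

lemma cv_intble (g : ℝ → ℝ) :
    IntegrableOn (fun x => g x / Real.sqrt (1 - x ^ 2)) (Set.Ioo (-1:ℝ) 1)
    ↔ IntegrableOn (fun t => g (Real.cos t)) (Set.Ioo 0 Real.pi) := by
  rw [← img_cos, integrableOn_image_iff_integrableOn_abs_deriv_smul (f' := fun t => -Real.sin t)
    measurableSet_Ioo (fun t _ => (Real.hasDerivAt_cos t).hasDerivWithinAt)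
    (Real.injOn_cos.mono Set.Ioo_subset_Icc_self)]
  exact integrableOn_congr_fun (cv_point g) measurableSet_Ioo

/-- log-sine of the half angle -/
noncomputable def GG (u : ℝ) : ℝ := Real.log (Real.sin (u / 2))

lemma GG_int (a b : ℝ) : IntervalIntegrable GG volume a b := by
  have := (intervalIntegrable_log_sin (a := a / 2) (b := b / 2)).comp_mul_left (c := 2⁻¹)
  have h := this
  simp only [div_inv_eq_mul] at h
  convert h using 1
  · ext u; simp [GG, div_eq_inv_mul]
  · ring
  · ring

lemma GG_per : Function.Periodic GG (2 * Real.pi) := by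
  intro u
  simp only [GG]
  rw [show (u + 2 * Real.pi) / 2 = u / 2 + Real.pi by ring, Real.sin_add_pi, Real.log_neg_eq_log]

lemma GG_even (u : ℝ) : GG (-u) = GG u := by
  simp only [GG]
  rw [neg_div, Real.sin_neg, Real.log_neg_eq_log]

lemma J_cos : ∫ u in (0:ℝ)..(2 * Real.pi), GG u * Real.cos u = -Real.pi := by
  have h := intervalIntegral.integral_eq_sub_of_hasDerivAt_of_le (a := 0) (b := 2 * Real.pi)
    (f := fun u => 2 * Real.cos (u/2) * (Real.sin (u / 2) * Real.log (Real.sin (u/2)))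
      - (u + Real.sin u) / 2) (f' := fun u => GG u * Real.cos u) (by positivity) ?_ ?_ ?_
  · rw [h]; simp
  · apply Continuous.continuousOn
    have : Continuous fun u : ℝ => Real.sin (u / 2) * Real.log (Real.sin (u/2)) :=
      Real.continuous_mul_log.comp (by fun_prop : Continuous fun u : ℝ => Real.sin (u / 2))
    fun_prop
  · intro u hu
    have hs : 0 < Real.sin (u/2) :=
      Real.sin_pos_of_pos_of_lt_pi (by linarith [hu.1]) (by linarith [hu.2])
    have h2 : HasDerivAt (fun u : ℝ => u / 2) (1/2) u := (hasDerivAt_id u).div_const 2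
    have hS := h2.sin
    have hC := h2.cos
    have hL := hS.log hs.ne'
    have := ((hC.const_mul 2).mul (hS.mul hL)).sub
      (((hasDerivAt_id u).add (Real.hasDerivAt_sin u)).div_const 2)
    refine this.congr_deriv ?_
    have hc : Real.cos u = 2 * Real.cos (u/2) ^ 2 - 1 := by
      rw [← Real.cos_two_mul]; ring_nf
    have hq := Real.sin_sq_add_cos_sq (u/2)
    simp only [GG, hc, Pi.mul_apply]
    field_simp
    have hq' : Real.sin (u/2) ^ 2 = 1 - Real.cos (u/2)^2 := by linarith
    rw [hq']
    ring
  · exact (GG_int _ _).mul_continuousOn Real.continuous_cos.continuousOn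

lemma J_sin : ∫ u in (0:ℝ)..(2 * Real.pi), GG u * Real.sin u = 0 := by
  have h := intervalIntegral.integral_comp_sub_left (a := 0) (b := 2 * Real.pi)
    (fun u => GG u * Real.sin u) (2 * Real.pi)
  have h2 : ∀ u, GG (2 * Real.pi - u) * Real.sin (2 * Real.pi - u) = - (GG u * Real.sin u) := by
    intro u
    rw [Real.sin_two_pi_sub, show 2 * Real.pi - u = -u + 2 * Real.pi by ring, GG_per, GG_even]
    ring
  simp only [h2, intervalIntegral.integral_neg, sub_self, sub_zero] at h
  linarith

lemma L_eq {θ t : ℝ} (hθ : θ ∈ Set.Ioo 0 Real.pi) (ht : t ∈ Set.Ioo 0 Real.pi) (hne : t ≠ θ) :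
    Real.log |Real.cos θ - Real.cos t| = Real.log 2 + GG (t + θ) + GG (t - θ) := by
  have h1 : Real.sin ((t + θ)/2) ≠ 0 := (Real.sin_pos_of_pos_of_lt_pi
    (by linarith [hθ.1, ht.1]) (by linarith [hθ.2, ht.2])).ne'
  have h2 : Real.sin ((t - θ)/2) ≠ 0 := by
    intro h
    rw [Real.sin_eq_zero_iff_of_lt_of_lt (by linarith [hθ.2, ht.1, Real.pi_pos])
      (by linarith [hθ.1, ht.2, Real.pi_pos])] at h
    exact hne (by linarith)
  have : Real.cos θ - Real.cos t = 2 * Real.sin ((t + θ)/2) * Real.sin ((t - θ)/2) := by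
    rw [Real.cos_sub_cos, show (θ - t)/2 = -((t - θ)/2) by ring, Real.sin_neg, add_comm θ t]
    ring
  rw [this, Real.log_abs, Real.log_mul (by positivity) h2, Real.log_mul two_ne_zero h1]
  rfl

lemma L_ae {θ : ℝ} (hθ : θ ∈ Set.Ioo 0 Real.pi) :
    ∀ᵐ t ∂(volume.restrict (Set.Ioo 0 Real.pi)),
    Real.log |Real.cos θ - Real.cos t| = Real.log 2 + GG (t + θ) + GG (t - θ) := by
  rw [ae_restrict_iff' measurableSet_Ioo]
  filter_upwards [Measure.ae_ne volume θ] with t hne ht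
  exact L_eq hθ ht hne

lemma GGp_int (θ a b : ℝ) : IntervalIntegrable (fun t => GG (t + θ)) volume a b := by
  simpa using (GG_int (a + θ) (b + θ)).comp_add_right θ

lemma GGm_int (θ a b : ℝ) : IntervalIntegrable (fun t => GG (t - θ)) volume a b := by
  simpa using (GG_int (a - θ) (b - θ)).comp_sub_right θ

/-- folding -/
lemma fold (θ : ℝ) (F : ℝ → ℝ) (hF : ∀ u, F (-u) = F u) (c : ℝ → ℝ) (hc : ∀ u, c (-u) = c u)
    (hi : ∀ a b, IntervalIntegrable (fun t => F (t + θ) * c t) volume a b)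
    (hp : Function.Periodic (fun t => F (t + θ) * c t) (2 * Real.pi)) :
    (∫ t in (0:ℝ)..Real.pi, F (t + θ) * c t) + (∫ t in (0:ℝ)..Real.pi, F (t - θ) * c t)
     = ∫ u in (0:ℝ)..(2 * Real.pi), F u * c (u - θ) := by
  have h1 : (∫ t in (0:ℝ)..Real.pi, F (t - θ) * c t)
      = ∫ t in (-Real.pi)..0, F (t + θ) * c t := by
    have := intervalIntegral.integral_comp_neg (a := 0) (b := Real.pi)
      (fun t => F (t + θ) * c t)
    rw [neg_zero] at this
    rw [← this]
    congr 1; ext t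
    rw [hc, ← hF, show -(t - θ) = -t + θ by ring]
  rw [h1, add_comm, intervalIntegral.integral_add_adjacent_intervals (hi _ _) (hi _ _)]
  have h2 := hp.intervalIntegral_add_eq (-Real.pi) (-θ)
  have h3 := intervalIntegral.integral_comp_sub_right (a := 0) (b := 2 * Real.pi)
    (fun t => F (t + θ) * c t) θ
  simp only [sub_add_cancel] at h3
  rw [h3]
  convert h2 using 2 <;> ring

lemma inner_int {θ : ℝ} (hθ : θ ∈ Set.Ioo 0 Real.pi) :
    ∫ t in Set.Ioo 0 Real.pi, Real.log |Real.cos θ - Real.cos t| * Real.cos t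
      = -Real.pi * Real.cos θ := by
  have hp : ∀ a b, IntervalIntegrable (fun t => GG (t + θ) * Real.cos t) volume a b := fun a b =>
    (GGp_int θ a b).mul_continuousOn Real.continuous_cos.continuousOn
  have hm : ∀ a b, IntervalIntegrable (fun t => GG (t - θ) * Real.cos t) volume a b := fun a b =>
    (GGm_int θ a b).mul_continuousOn Real.continuous_cos.continuousOn
  have e : ∫ t in Set.Ioo 0 Real.pi, Real.log |Real.cos θ - Real.cos t| * Real.cos t
      = ∫ t in Set.Ioo 0 Real.pi, (Real.log 2 * Real.cos t + GG (t + θ) * Real.cos t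
        + GG (t - θ) * Real.cos t) := by
    apply integral_congr_ae
    filter_upwards [L_ae hθ] with t ht
    rw [ht]; ring
  have hl : IntervalIntegrable (fun t => Real.log 2 * Real.cos t) volume 0 Real.pi :=
    Continuous.intervalIntegrable (by fun_prop) _ _
  rw [e, ← integral_Ioc_eq_integral_Ioo, ← intervalIntegral.integral_of_le Real.pi_pos.le,
    intervalIntegral.integral_add (hl.add (hp _ _)) (hm _ _),
    intervalIntegral.integral_add hl (hp _ _), intervalIntegral.integral_const_mul, integral_cos,
    add_assoc, fold θ GG GG_even Real.cos Real.cos_neg hp]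
  · have : ∀ u, GG u * Real.cos (u - θ)
        = Real.cos θ * (GG u * Real.cos u) + Real.sin θ * (GG u * Real.sin u) := by
      intro u; rw [Real.cos_sub]; ring
    simp only [this]
    rw [intervalIntegral.integral_add, intervalIntegral.integral_const_mul,
      intervalIntegral.integral_const_mul, J_cos, J_sin]
    · simp; ring
    · exact ((GG_int _ _).mul_continuousOn Real.continuous_cos.continuousOn).const_mul _
    · exact ((GG_int _ _).mul_continuousOn Real.continuous_sin.continuousOn).const_mul _
  · intro t
    simp only
    rw [Real.cos_add_two_pi, add_right_comm, GG_per]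

lemma L_intble {θ : ℝ} (hθ : θ ∈ Set.Ioo 0 Real.pi) :
    IntegrableOn (fun t => Real.log |Real.cos θ - Real.cos t|) (Set.Ioo 0 Real.pi) := by
  have h : IntervalIntegrable (fun t => Real.log 2 + GG (t + θ) + GG (t - θ))
    volume 0 Real.pi := ((intervalIntegrable_const (c := Real.log 2)).add (GGp_int θ _ _)).add (GGm_int θ _ _)
  rw [intervalIntegrable_iff_integrableOn_Ioo_of_le Real.pi_pos.le] at h
  exact h.congr ((L_ae hθ).mono fun t ht => ht.symm)

lemma L_bound {θ : ℝ} (hθ : θ ∈ Set.Ioo 0 Real.pi) :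
    ∫ t in Set.Ioo 0 Real.pi, |(Real.log |Real.cos θ - Real.cos t|)|
      ≤ Real.pi * Real.log 2 + ∫ u in (0:ℝ)..(2 * Real.pi), |GG u| := by
  have hp := fun a b => (GGp_int θ a b).abs
  have hm := fun a b => (GGm_int θ a b).abs
  have hf := fold θ (fun u => |GG u|) (fun u => by rw [GG_even]) (fun _ => 1) (fun _ => rfl)
    (by simpa using hp) (by
      intro t
      simp only
      rw [add_right_comm, GG_per])
  simp only [mul_one] at hf
  have hl : IntervalIntegrable (fun _ : ℝ => Real.log 2) volume 0 Real.pi :=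
    intervalIntegrable_const
  have hi := (hl.add (hp 0 Real.pi)).add (hm 0 Real.pi)
  have e : ∫ t in Set.Ioo 0 Real.pi, |(Real.log |Real.cos θ - Real.cos t|)|
      ≤ ∫ t in Set.Ioo 0 Real.pi, (Real.log 2 + |GG (t + θ)| + |GG (t - θ)|) := by
    apply integral_mono_ae (L_intble hθ).abs
    · exact (intervalIntegrable_iff_integrableOn_Ioo_of_le Real.pi_pos.le).1 hi
    filter_upwards [L_ae hθ] with t ht
    rw [ht]
    refine (abs_add_le _ _).trans ?_
    gcongr
    refine (abs_add_le _ _).trans ?_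
    rw [abs_of_pos (Real.log_pos one_lt_two)]
  refine e.trans (le_of_eq ?_)
  rw [← integral_Ioc_eq_integral_Ioo, ← intervalIntegral.integral_of_le Real.pi_pos.le,
    intervalIntegral.integral_add (hl.add (hp _ _)) (hm _ _),
    intervalIntegral.integral_add hl (hp _ _), add_assoc, hf]
  simp

/-- The energy norm of the exact solution `φ(x) = −x/√(1−x²)` of the slit crack problem:
`⟨Vφ, φ⟩ = −(1/(2π)) ∫∫ log|x−y| φ(x)φ(y) dy dx = π/4`. -/
theorem stmt12 :
    IntegrableOn
      (fun p : ℝ × ℝ => p.1 * p.2 * Real.log |p.1 - p.2| /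
        (Real.sqrt (1 - p.1 ^ 2) * Real.sqrt (1 - p.2 ^ 2)))
      (Set.Ioo (-1 : ℝ) 1 ×ˢ Set.Ioo (-1 : ℝ) 1) ∧
    -(1 / (2 * Real.pi)) *
        ∫ x in Set.Ioo (-1 : ℝ) 1, ∫ y in Set.Ioo (-1 : ℝ) 1,
          Real.log |x - y| * (-x / Real.sqrt (1 - x ^ 2)) * (-y / Real.sqrt (1 - y ^ 2))
      = Real.pi / 4 := by
  constructor
  · rw [IntegrableOn, Measure.volume_eq_prod, ← Measure.prod_restrict]
    have hmeas : Measurable (fun p : ℝ × ℝ => p.1 * p.2 * Real.log |p.1 - p.2| /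
        (Real.sqrt (1 - p.1 ^ 2) * Real.sqrt (1 - p.2 ^ 2))) := by
      have h1 : Measurable fun p : ℝ × ℝ => Real.log |p.1 - p.2| :=
        Real.measurable_log.comp (by fun_prop : Continuous fun p : ℝ × ℝ => |p.1 - p.2|).measurable
      have h2 : Measurable fun p : ℝ × ℝ => (Real.sqrt (1 - p.1 ^ 2) * Real.sqrt (1 - p.2 ^ 2)) :=
        (by fun_prop : Continuous fun p : ℝ × ℝ =>
          (Real.sqrt (1 - p.1 ^ 2) * Real.sqrt (1 - p.2 ^ 2))).measurable
      exact ((measurable_fst.mul measurable_snd).mul h1).div h2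
    have hpt : ∀ x ∈ Set.Ioo (-1:ℝ) 1, IntegrableOn
        (fun y => Real.log |x - y| / Real.sqrt (1 - y ^ 2)) (Set.Ioo (-1:ℝ) 1) := by
      intro x hx
      rw [← img_cos] at hx
      obtain ⟨θ, hθ, rfl⟩ := hx
      rw [cv_intble (fun y => Real.log |Real.cos θ - y|)]
      exact L_intble hθ
    have hpt2 : ∀ x ∈ Set.Ioo (-1:ℝ) 1, IntegrableOn
        (fun y => x * y * Real.log |x - y| /
          (Real.sqrt (1 - x ^ 2) * Real.sqrt (1 - y ^ 2))) (Set.Ioo (-1:ℝ) 1) := by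
      intro x hx
      have := ((hpt x hx).bdd_mul (c := 1) (f := fun y => y)
        measurable_id.aestronglyMeasurable (by
          rw [ae_restrict_iff' measurableSet_Ioo]
          refine Filter.Eventually.of_forall fun y hy => ?_
          rw [Real.norm_eq_abs, abs_le]; exact ⟨hy.1.le, hy.2.le⟩)).const_mul
            (x / Real.sqrt (1 - x ^ 2))
      refine this.congr (Filter.Eventually.of_forall fun y => ?_)
      simp only
      simp only [div_eq_mul_inv, mul_inv]
      ring
    rw [integrable_prod_iff hmeas.aestronglyMeasurable]
    refine ⟨?_, ?_⟩
    · rw [ae_restrict_iff' measurableSet_Ioo]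
      exact Filter.Eventually.of_forall hpt2
    · set C := Real.pi * Real.log 2 + ∫ u in (0:ℝ)..(2 * Real.pi), |GG u| with hC
      have hdom : IntegrableOn (fun x => C / Real.sqrt (1 - x ^ 2)) (Set.Ioo (-1:ℝ) 1) := by
        rw [cv_intble (fun _ => C)]
        exact integrableOn_const (by simp)
      refine Integrable.mono' hdom
        (hmeas.norm.aestronglyMeasurable.integral_prod_right') ?_
      rw [ae_restrict_iff' measurableSet_Ioo]
      refine Filter.Eventually.of_forall fun x hx => ?_
      rw [Real.norm_of_nonneg (integral_nonneg fun _ => norm_nonneg _)]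
      have hb : ∫ y in Set.Ioo (-1:ℝ) 1, |(Real.log |x - y|)| / Real.sqrt (1 - y ^ 2) ≤ C := by
        rw [cv_int (fun y => |(Real.log |x - y|)|)]
        rw [← img_cos] at hx
        obtain ⟨θ, hθ, rfl⟩ := hx
        exact L_bound hθ
      have hle : ∫ y in Set.Ioo (-1:ℝ) 1, ‖x * y * Real.log |x - y| /
          (Real.sqrt (1 - x ^ 2) * Real.sqrt (1 - y ^ 2))‖
          ≤ ∫ y in Set.Ioo (-1:ℝ) 1, (1 / Real.sqrt (1 - x ^ 2)) *
            (|(Real.log |x - y|)| / Real.sqrt (1 - y ^ 2)) := by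
        refine setIntegral_mono_on (hpt2 x hx).norm ?_ measurableSet_Ioo ?_
        · refine Integrable.const_mul ?_ _
          refine (hpt x hx).norm.congr (Filter.Eventually.of_forall fun y => ?_)
          simp only [norm_div, Real.norm_eq_abs, abs_of_nonneg (Real.sqrt_nonneg _)]
        · intro y hy
          rw [norm_div, norm_mul, norm_mul, norm_mul, Real.norm_of_nonneg (Real.sqrt_nonneg _),
            Real.norm_of_nonneg (Real.sqrt_nonneg _), div_mul_div_comm]
          have hx1 : |x| ≤ 1 := abs_le.2 ⟨hx.1.le, hx.2.le⟩
          have hy1 : |y| ≤ 1 := abs_le.2 ⟨hy.1.le, hy.2.le⟩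
          simp only [Real.norm_eq_abs]
          gcongr
          exact mul_le_one₀ hx1 (abs_nonneg _) hy1
      refine hle.trans ?_
      rw [integral_const_mul, div_eq_mul_one_div C, mul_comm C]
      gcongr
  · have h1 : ∀ x ∈ Set.Ioo (-1:ℝ) 1, ∫ y in Set.Ioo (-1 : ℝ) 1,
          Real.log |x - y| * (-x / Real.sqrt (1 - x ^ 2)) * (-y / Real.sqrt (1 - y ^ 2))
          = (-Real.pi * x ^ 2) / Real.sqrt (1 - x ^ 2) := by
      intro x hx
      have : ∀ y, Real.log |x - y| * (-x / Real.sqrt (1 - x ^ 2)) * (-y / Real.sqrt (1 - y ^ 2))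
          = (x / Real.sqrt (1 - x ^ 2)) * ((Real.log |x - y| * y) / Real.sqrt (1 - y ^ 2)) := by
        intro y; ring
      simp only [this]
      rw [integral_const_mul, cv_int (fun y => Real.log |x - y| * y)]
      rw [← img_cos] at hx
      obtain ⟨θ, hθ, rfl⟩ := hx
      rw [inner_int hθ]
      ring
    rw [setIntegral_congr_fun measurableSet_Ioo h1, cv_int (fun x => -Real.pi * x ^ 2),
      integral_const_mul, ← integral_Ioc_eq_integral_Ioo,
      ← intervalIntegral.integral_of_le Real.pi_pos.le, integral_cos_sq]
    have := Real.pi_pos.ne'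
    simp
    field_simp
    norm_num
end

section
/- For every natural number d and every real L ≥ 1 there exists a constant C > 0, depending only on d and L, with the following property. Let p be a natural number, let a < b with b − a ≤ L, let 0 < h < e^{-1} and K ≥ 0, let s ∈ [a, b], and let D ⊆ [a, b] be a closed interval of length (d+1)h. Let B : ℝ → ℝ be measurable with 0 ≤ B(t) ≤ 1 for all t and B(t) = 0 for t ∉ D, and let g, σ : D → ℝ be continuous with |g(t) − σ(t)| ≤ K h^{p+1} for all t ∈ D. Then the function t ↦ log|s − t| · B(t) · (g(t) − σ(t)) is integrable on D and | ∫_D log|s − t| · B(t) · (g(t) − σ(t)) dt | ≤ C K h^{p+2} |log h|. -/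
open MeasureTheory


lemma aux_intOn (s x y : ℝ) : IntegrableOn (fun t => Real.log |s - t|) (Set.Icc x y) := by
  rcases le_total x y with hxy | hxy
  · rw [integrableOn_Icc_iff_integrableOn_Ioc, ← intervalIntegrable_iff_integrableOn_Ioc_of_le hxy]
    simp only [Real.log_abs]
    have h := (intervalIntegral.intervalIntegrable_log' (a := s - x) (b := s - y)).comp_sub_left s
    simpa using h
  · refine IntegrableOn.of_measure_zero ?_
    rw [Real.volume_Icc]
    simpa using hxy

lemma aux_near (s h : ℝ) (h0 : 0 < h) (h1 : h < 1) :
    ∫ t in Set.Icc (s - h) (s + h), |Real.log (|s - t|)| = 2 * h * (-Real.log h) + 2 * h := by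
  rw [integral_Icc_eq_integral_Ioc, ← intervalIntegral.integral_of_le (by linarith)]
  have e : ∫ t in (s - h)..(s + h), |Real.log (|s - t|)|
      = ∫ t in (s - h)..(s + h), - Real.log (s - t) := by
    apply intervalIntegral.integral_congr
    intro t ht
    rw [Set.uIcc_of_le (by linarith)] at ht
    have hle : |s - t| ≤ 1 := by
      rw [abs_le]; constructor <;> linarith [ht.1, ht.2]
    have := Real.log_nonpos (abs_nonneg _) hle
    show |Real.log (|s - t|)| = - Real.log (s - t)
    rw [abs_of_nonpos this, Real.log_abs]
  rw [e, intervalIntegral.integral_neg,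
    intervalIntegral.integral_comp_sub_left (fun u => Real.log u) s, integral_log]
  have e1 : s - (s + h) = -h := by ring
  have e2 : s - (s - h) = h := by ring
  rw [e1, e2, Real.log_neg_eq_log]
  ring

lemma aux_main (s c w L h : ℝ) (hL : 1 ≤ L) (h0 : 0 < h) (h1 : h < Real.exp (-1)) (hw : 0 ≤ w)
    (hs : ∀ t ∈ Set.Icc c (c + w * h), |s - t| ≤ L) :
    ∫ t in Set.Icc c (c + w * h), |Real.log (|s - t|)|
      ≤ (w * (Real.log L + 1) + 4) * h * |Real.log h| := by
  have hlog : Real.log h < -1 := (Real.log_lt_iff_lt_exp h0).2 h1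
  have hlt1 : h < 1 := h1.trans (by rw [Real.exp_lt_one_iff]; norm_num)
  have hLL : 0 ≤ Real.log L := Real.log_nonneg hL
  have habs : |Real.log h| = - Real.log h := abs_of_neg (by linarith)
  set F : ℝ → ℝ := (Set.Icc (s - h) (s + h)).indicator (fun t => |Real.log (|s - t|)|) with hF
  have hFi : Integrable F :=
    (integrable_indicator_iff measurableSet_Icc).2 (aux_intOn s (s - h) (s + h)).abs
  have hFn : ∀ t, 0 ≤ F t := fun t => Set.indicator_nonneg (fun _ _ => abs_nonneg _) t
  have hpt : ∀ t ∈ Set.Icc c (c + w * h),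
      |Real.log (|s - t|)| ≤ (Real.log L + |Real.log h|) + F t := by
    intro t ht
    by_cases hm : t ∈ Set.Icc (s - h) (s + h)
    · rw [hF, Set.indicator_of_mem hm]
      linarith [abs_nonneg (Real.log h)]
    · have hx : h ≤ |s - t| := by
        by_contra hc
        push Not at hc
        rw [abs_lt] at hc
        exact hm ⟨by linarith [hc.2], by linarith [hc.1]⟩
      have l1 := Real.log_le_log h0 hx
      have l2 := Real.log_le_log (h0.trans_le hx) (hs t ht)
      have := hFn t
      rw [habs]
      have : |Real.log (|s - t|)| ≤ Real.log L + -Real.log h := by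
        rw [abs_le]; constructor <;> linarith
      linarith
  have hconst : IntegrableOn (fun _ : ℝ => Real.log L + |Real.log h|) (Set.Icc c (c + w * h)) :=
    integrableOn_const (by rw [Real.volume_Icc]; exact ENNReal.ofReal_ne_top)
  have hFI : ∫ t in Set.Icc c (c + w * h), F t ≤ 2 * h * (-Real.log h) + 2 * h := by
    rw [← aux_near s h h0 hlt1, ← integral_indicator (s := Set.Icc (s - h) (s + h)) measurableSet_Icc]
    exact setIntegral_le_integral hFi (Filter.Eventually.of_forall hFn)
  calc _ ≤ ∫ t in Set.Icc c (c + w * h), ((Real.log L + |Real.log h|) + F t) :=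
        setIntegral_mono_on (aux_intOn s _ _).abs (hconst.add hFi.integrableOn)
          measurableSet_Icc hpt
    _ = w * h * (Real.log L + |Real.log h|) + ∫ t in Set.Icc c (c + w * h), F t := by
        rw [integral_add hconst hFi.integrableOn, setIntegral_const, Real.volume_real_Icc_of_le
          (by nlinarith [mul_nonneg hw h0.le])]
        simp
    _ ≤ _ := by
        rw [habs]
        have k1 : 0 ≤ w * h * Real.log L * (-Real.log h - 1) :=
          mul_nonneg (by positivity) (by linarith)
        have k2 : 0 ≤ h * (-Real.log h - 1) := mul_nonneg h0.le (by linarith)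
        nlinarith

/-- Quadrature error bound for weakly singular integrals with a B-spline weight factor:
there is `C > 0` depending only on `d` and `L` such that, for `s` in the parametric
interval `[a,b]` with `b − a ≤ L`, `B` a degree-`d` B-spline-like factor with values in
`[0,1]` supported on an interval `D ⊆ [a,b]` of length `(d+1)h`, `0 < h < e⁻¹`, and
`|g − σ| ≤ K h^{p+1}` on `D`, the function `t ↦ log|s−t|·B(t)·(g(t)−σ(t))` is integrable
on `D` and `|∫_D log|s−t| B (g − σ)| ≤ C K h^{p+2} |log h|`. -/
theorem stmt17 (d : ℕ) (L : ℝ) (hL : 1 ≤ L) :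
    ∃ C > 0, ∀ (p : ℕ) (a b h K s c : ℝ), a < b → b - a ≤ L →
      0 < h → h < Real.exp (-1) → 0 ≤ K → s ∈ Set.Icc a b →
      Set.Icc c (c + ((d : ℝ) + 1) * h) ⊆ Set.Icc a b →
      ∀ B g σ : ℝ → ℝ, Measurable B → (∀ t, 0 ≤ B t ∧ B t ≤ 1) →
        (∀ t ∉ Set.Icc c (c + ((d : ℝ) + 1) * h), B t = 0) →
        ContinuousOn g (Set.Icc c (c + ((d : ℝ) + 1) * h)) →
        ContinuousOn σ (Set.Icc c (c + ((d : ℝ) + 1) * h)) →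
        (∀ t ∈ Set.Icc c (c + ((d : ℝ) + 1) * h), |g t - σ t| ≤ K * h ^ (p + 1)) →
        IntegrableOn (fun t => Real.log |s - t| * B t * (g t - σ t))
            (Set.Icc c (c + ((d : ℝ) + 1) * h)) ∧
          |∫ t in Set.Icc c (c + ((d : ℝ) + 1) * h),
              Real.log |s - t| * B t * (g t - σ t)|
            ≤ C * K * h ^ (p + 2) * |Real.log h| := by
  have hLL : 0 ≤ Real.log L := Real.log_nonneg hL
  refine ⟨((d : ℝ) + 1) * (Real.log L + 1) + 4, by positivity, ?_⟩
  intro p a b h K s c hab hbL h0 h1 hK hs hD B g σ hBm hB hB0 hg hσ hE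
  set D := Set.Icc c (c + ((d : ℝ) + 1) * h) with hDdef
  have hlog : IntegrableOn (fun t => Real.log |s - t|) D := aux_intOn s _ _
  have hbd : ∀ t ∈ D, ‖Real.log |s - t| * B t * (g t - σ t)‖
      ≤ K * h ^ (p + 1) * |Real.log (|s - t|)| := by
    intro t ht
    rw [Real.norm_eq_abs, abs_mul, abs_mul, abs_of_nonneg (hB t).1]
    have e1 : |Real.log (|s - t|)| * B t ≤ |Real.log (|s - t|)| :=
      mul_le_of_le_one_right (abs_nonneg _) (hB t).2
    calc _ ≤ |Real.log (|s - t|)| * (K * h ^ (p + 1)) :=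
          mul_le_mul e1 (hE t ht) (abs_nonneg _) (abs_nonneg _)
      _ = _ := mul_comm _ _
  have hdom : IntegrableOn (fun t => K * h ^ (p + 1) * |Real.log (|s - t|)|) D :=
    hlog.abs.const_mul _
  have hae : ∀ᵐ t ∂(volume.restrict D), ‖Real.log |s - t| * B t * (g t - σ t)‖
      ≤ K * h ^ (p + 1) * |Real.log (|s - t|)| :=
    (ae_restrict_iff' measurableSet_Icc).2 (Filter.Eventually.of_forall hbd)
  refine ⟨Integrable.mono' hdom ?_ hae, ?_⟩
  · exact (hlog.aestronglyMeasurable.mul hBm.aestronglyMeasurable).mul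
      ((hg.sub hσ).aestronglyMeasurable measurableSet_Icc)
  · have hm := aux_main s c ((d : ℝ) + 1) L h hL h0 h1 (by positivity) (by
      intro t ht
      have := hD ht
      rw [abs_le]
      constructor <;> linarith [this.1, this.2, hs.1, hs.2])
    calc _ ≤ ∫ t in D, K * h ^ (p + 1) * |Real.log (|s - t|)| :=
          norm_integral_le_of_norm_le hdom hae
      _ = K * h ^ (p + 1) * ∫ t in D, |Real.log (|s - t|)| := integral_const_mul _ _
      _ ≤ K * h ^ (p + 1) * ((((d : ℝ) + 1) * (Real.log L + 1) + 4) * h * |Real.log h|) :=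
          mul_le_mul_of_nonneg_left hm (by positivity)
      _ = _ := by ring
end
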